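/- arXiv:2406.18989 — 4 statements merged into one kernel-verified Lean document; each statement's English description precedes it below -/
import Mathlib

section
/- If Δ is a strongly edge decomposable simplicial complex of dimension d − 1, then its suspension S(Δ) is a strongly edge decomposable simplicial complex of dimension d. -/
open MvPolynomial

section Defs

variable {V : Type*}

def IsSimplicialComplex (Δ : Set (Finset V)) : Prop :=
  ∅ ∈ Δ ∧ ∀ σ ∈ Δ, ∀ τ ⊆ σ, τ ∈ Δ

/-- `HasDim Δ n` means `dim Δ = n`, i.e. all faces have at most `n+1` vertices
and some face has exactly `n+1` vertices. -/
def HasDim (Δ : Set (Finset V)) (n : ℕ) : Prop :=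
  (∀ σ ∈ Δ, σ.card ≤ n + 1) ∧ ∃ σ ∈ Δ, σ.card = n + 1

variable [DecidableEq V]

def link (Δ : Set (Finset V)) (σ : Finset V) : Set (Finset V) :=
  {τ | τ ∈ Δ ∧ τ ∪ σ ∈ Δ ∧ τ ∩ σ = ∅}

def closedStar (Δ : Set (Finset V)) (σ : Finset V) : Set (Finset V) :=
  {τ | τ ∈ Δ ∧ τ ∪ σ ∈ Δ}

def contraction (i j : V) (Δ : Set (Finset V)) : Set (Finset V) :=
  {τ | (τ ∈ Δ ∧ i ∉ τ) ∨ ∃ ρ ∈ Δ, i ∈ ρ ∧ τ = ρ.erase i ∪ {j}}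

def LinkCondition (Δ : Set (Finset V)) (i j : V) : Prop :=
  link Δ {i} ∩ link Δ {j} = link Δ {i, j}

inductive IsSED : Set (Finset V) → Prop
  | simplexBoundary (W : Finset V) (hW : W.Nonempty) : IsSED {σ : Finset V | σ ⊂ W}
  | contract (Δ : Set (Finset V)) (i j : V) (hij : i ≠ j) (hedge : ({i, j} : Finset V) ∈ Δ)
      (hlc : LinkCondition Δ i j) (hlink : IsSED (link Δ {i, j}))
      (hcontr : IsSED (contraction i j Δ)) : IsSED Δ

def suspension (w₁ w₂ : V) (Δ : Set (Finset V)) : Set (Finset V) :=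
  {τ | ∃ s ∈ ({∅, {w₁}, {w₂}} : Set (Finset V)), ∃ ρ ∈ Δ, τ = s ∪ ρ}

end Defs


section Helpers

variable {V : Type*} [DecidableEq V]

/-- Remove both apexes. -/
def core (w₁ w₂ : V) (τ : Finset V) : Finset V := (τ.erase w₁).erase w₂

lemma mem_core {w₁ w₂ a : V} {τ : Finset V} :
    a ∈ core w₁ w₂ τ ↔ a ≠ w₂ ∧ a ≠ w₁ ∧ a ∈ τ := by
  simp [core]

lemma mem_suspension {w₁ w₂ : V} (hw : w₁ ≠ w₂) {Δ : Set (Finset V)}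
    (h₁ : ∀ σ ∈ Δ, w₁ ∉ σ) (h₂ : ∀ σ ∈ Δ, w₂ ∉ σ) (τ : Finset V) :
    τ ∈ suspension w₁ w₂ Δ ↔ ¬ (w₁ ∈ τ ∧ w₂ ∈ τ) ∧ core w₁ w₂ τ ∈ Δ := by
  constructor
  · rintro ⟨s, hs, ρ, hρ, rfl⟩
    have a₁ := h₁ ρ hρ
    have a₂ := h₂ ρ hρ
    have hs' : s = ∅ ∨ s = {w₁} ∨ s = {w₂} := by simpa using hs
    have e : core w₁ w₂ (s ∪ ρ) = ρ := by
      ext a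
      rw [mem_core]
      rcases hs' with rfl | rfl | rfl <;> simp <;> grind
    rw [e]
    refine ⟨?_, hρ⟩
    rcases hs' with rfl | rfl | rfl <;> simp <;> grind
  · rintro ⟨h, hc⟩
    by_cases b₁ : w₁ ∈ τ
    · refine ⟨{w₁}, by simp, _, hc, ?_⟩
      ext a; simp only [Finset.mem_union, mem_core, Finset.mem_singleton]; grind
    · by_cases b₂ : w₂ ∈ τ
      · refine ⟨{w₂}, by simp, _, hc, ?_⟩
        ext a; simp only [Finset.mem_union, mem_core, Finset.mem_singleton]; grind
      · refine ⟨∅, by simp, _, hc, ?_⟩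
        ext a; simp only [Finset.mem_union, mem_core, Finset.notMem_empty]; grind

lemma link_suspension {w₁ w₂ : V} (hw : w₁ ≠ w₂) {Δ : Set (Finset V)}
    (h₁ : ∀ σ ∈ Δ, w₁ ∉ σ) (h₂ : ∀ σ ∈ Δ, w₂ ∉ σ) (e : Finset V)
    (e₁ : w₁ ∉ e) (e₂ : w₂ ∉ e) :
    link (suspension w₁ w₂ Δ) e = suspension w₁ w₂ (link Δ e) := by
  ext τ
  rw [mem_suspension hw (fun σ hσ => h₁ σ hσ.1) (fun σ hσ => h₂ σ hσ.1)]
  simp only [link, Set.mem_ofPred_eq, mem_suspension hw h₁ h₂]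
  have c : core w₁ w₂ (τ ∪ e) = core w₁ w₂ τ ∪ e := by
    ext a; simp only [Finset.mem_union, mem_core]; grind
  have c' : core w₁ w₂ τ ∩ e = τ ∩ e := by
    ext a; simp only [Finset.mem_inter, mem_core]; grind
  rw [c, c']
  simp only [Finset.mem_union]
  tauto

lemma contraction_suspension {w₁ w₂ : V} (hw : w₁ ≠ w₂) {Δ : Set (Finset V)}
    (h₁ : ∀ σ ∈ Δ, w₁ ∉ σ) (h₂ : ∀ σ ∈ Δ, w₂ ∉ σ) (i j : V)
    (i₁ : i ≠ w₁) (i₂ : i ≠ w₂) (j₁ : j ≠ w₁) (j₂ : j ≠ w₂)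
    (k₁ : ∀ σ ∈ contraction i j Δ, w₁ ∉ σ) (k₂ : ∀ σ ∈ contraction i j Δ, w₂ ∉ σ) :
    contraction i j (suspension w₁ w₂ Δ) = suspension w₁ w₂ (contraction i j Δ) := by
  ext τ
  rw [mem_suspension hw k₁ k₂]
  simp only [contraction, Set.mem_ofPred_eq, mem_suspension hw h₁ h₂]
  constructor
  · rintro (⟨⟨a, b⟩, c⟩ | ⟨ρ, ⟨a, b⟩, c, rfl⟩)
    · exact ⟨a, Or.inl ⟨b, by simp [mem_core, c]⟩⟩
    · refine ⟨by simp; grind, Or.inr ⟨_, b, by simp [mem_core, *], ?_⟩⟩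
      ext x; simp only [Finset.mem_union, mem_core, Finset.mem_erase, Finset.mem_singleton]; grind
  · rintro ⟨a, ⟨b, c⟩ | ⟨ρ, b, c, d⟩⟩
    · exact Or.inl ⟨⟨a, b⟩, by simpa [mem_core, i₁, i₂] using c⟩
    · right
      have r₁ := h₁ ρ b
      have r₂ := h₂ ρ b
      have hd : ∀ x, (x ≠ w₂ ∧ x ≠ w₁ ∧ x ∈ τ) ↔ ((x ≠ i ∧ x ∈ ρ) ∨ x = j) := by
        intro x
        rw [← mem_core, d]; simp [or_comm]
      refine ⟨ρ ∪ τ.filter (fun x => x = w₁ ∨ x = w₂), ⟨?_, ?_⟩, by simp [c], ?_⟩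
      · simp; grind
      · convert b using 1
        ext x; simp only [Finset.mem_union, mem_core, Finset.mem_filter]; grind
      · ext x
        simp only [Finset.mem_union, Finset.mem_filter, Finset.mem_erase, Finset.mem_singleton]
        have := hd x
        grind

lemma base_case {w₁ w₂ : V} (hw : w₁ ≠ w₂) (W : Finset V) (hW : W.Nonempty)
    (h₁ : ∀ σ ∈ {σ : Finset V | σ ⊂ W}, w₁ ∉ σ) (h₂ : ∀ σ ∈ {σ : Finset V | σ ⊂ W}, w₂ ∉ σ) :
    IsSED (suspension w₁ w₂ {σ : Finset V | σ ⊂ W}) := by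
  obtain ⟨v, hv⟩ := hW
  by_cases hs : W = {v}
  · have : suspension w₁ w₂ {σ : Finset V | σ ⊂ W} = {σ | σ ⊂ ({w₁, w₂} : Finset V)} := by
      ext τ
      rw [mem_suspension hw h₁ h₂]
      subst hs
      simp only [Set.mem_ofPred_eq, Finset.ssubset_singleton_iff, Finset.ssubset_iff_subset_ne,
        Finset.eq_empty_iff_forall_notMem, Finset.subset_iff, mem_core, ne_eq, Finset.ext_iff,
        Finset.mem_insert, Finset.mem_singleton]
      grind
    rw [this]
    exact IsSED.simplexBoundary _ (by simp)
  · obtain ⟨u, hu, huv⟩ : ∃ u ∈ W, u ≠ v := by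
      by_contra! h
      exact hs (Finset.eq_singleton_iff_unique_mem.2 ⟨hv, h⟩)
    have sing : ∀ x ∈ W, ({x} : Finset V) ⊂ W := by
      intro x hx
      rw [Finset.ssubset_iff_subset_ne]
      refine ⟨by simpa using hx, ?_⟩
      rintro rfl
      simp at hu hv; grind
    have n₁ : w₁ ∉ W := fun h => h₁ _ (sing _ h) (by simp)
    have n₂ : w₂ ∉ W := fun h => h₂ _ (sing _ h) (by simp)
    have key : ∀ τ : Finset V, τ ∈ suspension w₁ w₂ {σ : Finset V | σ ⊂ W} ↔
        ¬ (w₁ ∈ τ ∧ w₂ ∈ τ) ∧ (∀ x ∈ τ, x = w₁ ∨ x = w₂ ∨ x ∈ W) ∧ ∃ x ∈ W, x ∉ τ := by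
      intro τ
      rw [mem_suspension hw h₁ h₂]
      simp only [Set.mem_ofPred_eq, Finset.ssubset_iff_of_subset, Finset.ssubset_def,
        Finset.subset_iff, mem_core]
      push Not
      grind
    generalize suspension w₁ w₂ {σ : Finset V | σ ⊂ W} = S at key ⊢
    clear h₁ h₂ sing hs
    have hl : ∀ τ, τ ∈ link S {w₁, v} ↔
        τ ⊂ W.erase v := by
      intro τ
      simp only [link, Set.mem_ofPred_eq, key, Finset.ssubset_def, Finset.subset_iff,
        Finset.eq_empty_iff_forall_notMem, Finset.mem_union, Finset.mem_inter, Finset.mem_insert,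
        Finset.mem_singleton, Finset.mem_erase]
      push Not
      grind
    refine IsSED.contract _ w₁ v (by grind) ?_ ?_ ?_ ?_
    · rw [key]
      simp only [Finset.mem_insert, Finset.mem_singleton]
      grind
    · ext τ
      rw [hl]
      simp only [link, Set.mem_inter_iff, Set.mem_ofPred_eq, key, Finset.ssubset_def,
        Finset.subset_iff,
        Finset.eq_empty_iff_forall_notMem, Finset.mem_union, Finset.mem_inter,
        Finset.mem_singleton, Finset.mem_erase]
      push Not
      clear hl key
      constructor
      · grind
      · grind (splits := 40)
    · rw [show link S {w₁, v} = {τ | τ ⊂ W.erase v} from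
        Set.ext hl]
      exact IsSED.simplexBoundary _ ⟨u, by simp [hu, huv]⟩
    · have : contraction w₁ v S =
          {τ | τ ⊂ insert w₂ W} := by
        ext τ
        simp only [contraction, Set.mem_ofPred_eq, key, Finset.ssubset_def, Finset.subset_iff,
          Finset.mem_insert]
        push Not
        constructor
        · rintro (h | ⟨ρ, h, h', rfl⟩)
          · grind
          · simp only [Finset.mem_union, Finset.mem_erase, Finset.mem_singleton]
            grind
        · rintro ⟨a, y, hy, hy'⟩
          by_cases hz : ∃ x ∈ W, x ∉ τ
          · left; grind
          · right
            push Not at hz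
            refine ⟨insert w₁ (τ.erase v), ?_, by simp, ?_⟩
            · simp only [Finset.mem_insert, Finset.mem_erase]
              grind
            · ext x
              simp only [Finset.mem_insert, Finset.mem_erase, Finset.mem_union,
                Finset.mem_singleton]
              grind
      rw [this]
      exact IsSED.simplexBoundary _ (by simp)

lemma sed_suspension {w₁ w₂ : V} (hw : w₁ ≠ w₂) {Δ : Set (Finset V)} (h : IsSED Δ) :
    (∀ σ ∈ Δ, w₁ ∉ σ) → (∀ σ ∈ Δ, w₂ ∉ σ) → IsSED (suspension w₁ w₂ Δ) := by
  induction h with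
  | simplexBoundary W hW => exact base_case hw W hW
  | contract Δ i j hij hedge hlc hlink hcontr ih₁ ih₂ =>
    intro h₁ h₂
    have a₁ := h₁ _ hedge
    have a₂ := h₂ _ hedge
    simp only [Finset.mem_insert, Finset.mem_singleton, not_or] at a₁ a₂
    have k : ∀ w, w ≠ j → (∀ σ ∈ Δ, w ∉ σ) → ∀ σ ∈ contraction i j Δ, w ∉ σ := by
      rintro w hj h σ (⟨b, c⟩ | ⟨ρ, b, c, rfl⟩)
      · exact h σ b
      · simp [h ρ b, hj]
    have k₁ := k w₁ a₁.2 h₁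
    have k₂ := k w₂ a₂.2 h₂
    refine IsSED.contract _ i j hij ⟨∅, by simp, _, hedge, by simp⟩ ?_ ?_ ?_
    · unfold LinkCondition at *
      rw [link_suspension hw h₁ h₂ _ (by simp; tauto) (by simp; tauto),
        link_suspension hw h₁ h₂ _ (by simp; tauto) (by simp; tauto),
        link_suspension hw h₁ h₂ _ (by simp; tauto) (by simp; tauto), ← hlc]
      ext τ
      rw [Set.mem_inter_iff,
        mem_suspension hw (fun σ hσ => h₁ σ hσ.1) (fun σ hσ => h₂ σ hσ.1),
        mem_suspension hw (fun σ hσ => h₁ σ hσ.1) (fun σ hσ => h₂ σ hσ.1),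
        mem_suspension hw (fun σ hσ => h₁ σ hσ.1.1) (fun σ hσ => h₂ σ hσ.1.1),
        Set.mem_inter_iff]
      tauto
    · rw [link_suspension hw h₁ h₂ _ (by simp; tauto) (by simp; tauto)]
      exact ih₁ (fun σ hσ => h₁ σ hσ.1) (fun σ hσ => h₂ σ hσ.1)
    · rw [contraction_suspension hw h₁ h₂ i j (Ne.symm a₁.1) (Ne.symm a₂.1) (Ne.symm a₁.2)
        (Ne.symm a₂.2) k₁ k₂]
      exact ih₂ k₁ k₂

end Helpers

/-- Proposition 4.1 of the paper. If `Δ` is a strongly edge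
decomposable simplicial complex of dimension `d - 1`, then its suspension `S(Δ)`
(with two new vertices `w₁ ≠ w₂` not occurring in any face of `Δ`) is a strongly
edge decomposable simplicial complex of dimension `d`. -/
theorem suspension_of_sed_is_sed
    {V : Type*} [DecidableEq V] (Δ : Set (Finset V)) (d : ℕ) (hd : 1 ≤ d)
    (w₁ w₂ : V) (hw : w₁ ≠ w₂)
    (hw₁ : ∀ σ ∈ Δ, w₁ ∉ σ) (hw₂ : ∀ σ ∈ Δ, w₂ ∉ σ)
    (hcomplex : IsSimplicialComplex Δ) (hsed : IsSED Δ) (hdim : HasDim Δ (d - 1)) :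
    IsSED (suspension w₁ w₂ Δ) ∧ HasDim (suspension w₁ w₂ Δ) d := by
  refine ⟨sed_suspension hw hsed hw₁ hw₂, ?_, ?_⟩
  · rintro τ ⟨s, hs, ρ, hρ, rfl⟩
    have hs' : s = ∅ ∨ s = {w₁} ∨ s = {w₂} := by simpa using hs
    have c : s.card ≤ 1 := by rcases hs' with rfl | rfl | rfl <;> simp
    have := Finset.card_union_le s ρ
    have := hdim.1 ρ hρ
    omega
  · obtain ⟨ρ, hρ, hc⟩ := hdim.2
    refine ⟨{w₁} ∪ ρ, ⟨{w₁}, by simp, ρ, hρ, rfl⟩, ?_⟩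
    rw [Finset.card_union_of_disjoint (by simpa using hw₁ ρ hρ)]
    simp only [Finset.card_singleton]
    omega
end

section
/- Let Δ be a simplicial complex on a finite vertex set V and σ = {i,j} an edge of Δ such that Δ satisfies the link condition with respect to σ, i.e. lk_Δ{i} ∩ lk_Δ{j} = lk_Δ σ. Then the suspension S(Δ) (with two new vertices w₁, w₂ ∉ V) also satisfies the link condition with respect to σ: lk_{S(Δ)}{i} ∩ lk_{S(Δ)}{j} = lk_{S(Δ)} σ. -/
open MvPolynomial

theorem mem_suspension_iff {V : Type*} [DecidableEq V] (Δ : Set (Finset V))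
    (w₁ w₂ : V) (hw : w₁ ≠ w₂)
    (hw₁ : ∀ σ ∈ Δ, w₁ ∉ σ) (hw₂ : ∀ σ ∈ Δ, w₂ ∉ σ) (τ : Finset V) :
    τ ∈ suspension w₁ w₂ Δ ↔ ¬ (w₁ ∈ τ ∧ w₂ ∈ τ) ∧ τ \ {w₁, w₂} ∈ Δ := by
  constructor
  · rintro ⟨s, hs, ρ, hρ, rfl⟩
    have h1 := hw₁ ρ hρ
    have h2 := hw₂ ρ hρ
    simp only [Set.mem_insert_iff, Set.mem_singleton_iff] at hs
    have e : (s ∪ ρ) \ {w₁, w₂} = ρ := by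
      ext x
      rcases hs with rfl | rfl | rfl <;> grind
    rw [e]
    refine ⟨?_, hρ⟩
    rcases hs with rfl | rfl | rfl <;> grind
  · rintro ⟨hn, hτ⟩
    by_cases h1 : w₁ ∈ τ
    · exact ⟨{w₁}, by simp, _, hτ, by ext x; grind⟩
    · by_cases h2 : w₂ ∈ τ
      · exact ⟨{w₂}, by simp, _, hτ, by ext x; grind⟩
      · exact ⟨∅, by simp, _, hτ, by ext x; grind⟩

theorem mem_link_suspension_iff {V : Type*} [DecidableEq V] (Δ : Set (Finset V))
    (w₁ w₂ : V) (hw : w₁ ≠ w₂)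
    (hw₁ : ∀ σ ∈ Δ, w₁ ∉ σ) (hw₂ : ∀ σ ∈ Δ, w₂ ∉ σ) (σ : Finset V)
    (h1 : w₁ ∉ σ) (h2 : w₂ ∉ σ) (τ : Finset V) :
    τ ∈ link (suspension w₁ w₂ Δ) σ ↔
      ¬ (w₁ ∈ τ ∧ w₂ ∈ τ) ∧ τ \ {w₁, w₂} ∈ link Δ σ := by
  have e1 : (τ ∪ σ) \ {w₁, w₂} = τ \ {w₁, w₂} ∪ σ := by ext x; grind
  have e2 : τ \ {w₁, w₂} ∩ σ = τ ∩ σ := by ext x; grind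
  simp only [link, Set.mem_setOf_eq, mem_suspension_iff Δ w₁ w₂ hw hw₁ hw₂, e1, e2,
    Finset.mem_union, h1, h2, or_false]
  tauto

/-- fact (b) in the proof of Proposition 4.1. If a simplicial
complex `Δ` on a finite vertex set satisfies the link condition with respect to an
edge `σ = {i, j}`, then so does its suspension `S(Δ)` (with two new vertices
`w₁ ≠ w₂` not occurring in any face of `Δ`). -/
theorem suspension_link_condition
    {V : Type*} [DecidableEq V] [Fintype V] (Δ : Set (Finset V))
    (hcomplex : IsSimplicialComplex Δ)
    (i j : V) (hij : i ≠ j) (hedge : ({i, j} : Finset V) ∈ Δ)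
    (w₁ w₂ : V) (hw : w₁ ≠ w₂)
    (hw₁ : ∀ σ ∈ Δ, w₁ ∉ σ) (hw₂ : ∀ σ ∈ Δ, w₂ ∉ σ)
    (hlc : LinkCondition Δ i j) :
    LinkCondition (suspension w₁ w₂ Δ) i j := by
  have h1 := hw₁ _ hedge
  have h2 := hw₂ _ hedge
  unfold LinkCondition at hlc ⊢
  ext τ
  rw [Set.mem_inter_iff, mem_link_suspension_iff Δ w₁ w₂ hw hw₁ hw₂ {i} (by grind) (by grind),
    mem_link_suspension_iff Δ w₁ w₂ hw hw₁ hw₂ {j} (by grind) (by grind),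
    mem_link_suspension_iff Δ w₁ w₂ hw hw₁ hw₂ {i, j} h1 h2, ← hlc, Set.mem_inter_iff]
  tauto
end

section
/- Let V be a finite set with d + 1 elements (d ≥ 1), let ∂Γ be the boundary of the d-simplex on V (the complex of all proper subsets of V), and let S(∂Γ) be its suspension with two new vertices w₁, w₂ ∉ V. Let σ = {i,j} be any edge of S(∂Γ) not belonging to ∂Γ, i.e. an edge with exactly one endpoint in {w₁, w₂}. Then the contraction C(σ, S(∂Γ)) (which deletes the vertex i) is the boundary of the (d+1)-simplex on the (d+2)-element vertex set (V ∪ {w₁, w₂}) ∖ {i}, i.e. the complex of all proper subsets of (V ∪ {w₁, w₂}) ∖ {i}. -/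
open MvPolynomial

theorem mem_susp_iff {V : Type*} [DecidableEq V] (W : Finset V)
    (w₁ w₂ : V) (hw : w₁ ≠ w₂) (hw₁ : w₁ ∉ W) (hw₂ : w₂ ∉ W) (τ : Finset V) :
    τ ∈ suspension w₁ w₂ {σ : Finset V | σ ⊂ W} ↔
      (∀ x ∈ τ, x ∈ W ∨ x = w₁ ∨ x = w₂) ∧ ¬ (w₁ ∈ τ ∧ w₂ ∈ τ) ∧ ∃ x ∈ W, x ∉ τ := by
  constructor
  · rintro ⟨s, hs, ρ, hρ, rfl⟩
    obtain ⟨h1, x, hx, hxρ⟩ := Finset.ssubset_iff_exists_subset_erase.trans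
      (by simp [Finset.subset_erase]; tauto :
        (∃ a ∈ W, ρ ⊆ W.erase a) ↔ ρ ⊆ W ∧ ∃ a ∈ W, a ∉ ρ) |>.1
        hρ
    simp only [Set.mem_insert_iff, Set.mem_singleton_iff] at hs
    have h2 : ∀ y ∈ ρ, y ∈ W := fun y hy => h1 hy
    refine ⟨?_, ?_, x, hx, ?_⟩ <;> rcases hs with rfl | rfl | rfl <;> grind
  · rintro ⟨h1, h2, x, hx, hxτ⟩
    refine ⟨τ.filter (· ∉ W), ?_, τ.filter (· ∈ W), ?_, ?_⟩
    · simp only [Set.mem_insert_iff, Set.mem_singleton_iff]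
      by_cases a : w₁ ∈ τ
      · right; left; ext y; grind
      · by_cases b : w₂ ∈ τ
        · right; right; ext y; grind
        · left; ext y; grind
    · refine ⟨fun y hy => by grind, fun h => ?_⟩
      have := h hx
      grind
    · ext y; grind

theorem ssub_iff {V : Type*} [DecidableEq V] (s t : Finset V) :
    s ⊂ t ↔ (∀ x ∈ s, x ∈ t) ∧ ∃ x ∈ t, x ∉ s := by
  rw [Finset.ssubset_def, Finset.subset_iff, Finset.not_subset]

theorem contr_aux {V : Type*} [DecidableEq V]
    (W : Finset V) (w₁ w₂ : V) (hw : w₁ ≠ w₂) (hw₁ : w₁ ∉ W) (hw₂ : w₂ ∉ W)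
    (i j : V) (h : (i = w₁ ∧ j ∈ W) ∨ (i ∈ W ∧ j = w₁)) :
    contraction i j (suspension w₁ w₂ {σ : Finset V | σ ⊂ W}) =
      {σ : Finset V | σ ⊂ (W ∪ {w₁, w₂}).erase i} := by
  ext τ
  change ((τ ∈ suspension w₁ w₂ _ ∧ i ∉ τ) ∨ ∃ ρ ∈ suspension w₁ w₂ _, i ∈ ρ ∧
    τ = ρ.erase i ∪ {j}) ↔ τ ⊂ (W ∪ {w₁, w₂}).erase i
  rw [ssub_iff]
  simp only [mem_susp_iff W w₁ w₂ hw hw₁ hw₂]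
  constructor
  · rintro (⟨⟨h1, h2, x, hx, hxτ⟩, h3⟩ | ⟨ρ, ⟨h1, h2, x, hx, hxτ⟩, h3, rfl⟩)
    · refine ⟨by grind, ?_⟩
      rcases h with ⟨rfl, h⟩ | ⟨h, rfl⟩
      · exact ⟨x, by grind, hxτ⟩
      · by_cases a : j ∈ τ
        · exact ⟨w₂, by grind, by grind⟩
        · exact ⟨j, by grind, by grind⟩
    · refine ⟨by grind, ?_⟩
      rcases h with ⟨rfl, h⟩ | ⟨h, rfl⟩
      · exact ⟨w₂, by grind, by grind⟩
      · exact ⟨x, by grind, by grind⟩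
  · rintro ⟨h1, x, hx, hxτ⟩
    have hiτ : i ∉ τ := by grind
    rcases h with ⟨rfl, h⟩ | ⟨h, rfl⟩
    · by_cases a : ∃ y ∈ W, y ∉ τ
      · left; exact ⟨⟨by grind, by grind, a⟩, hiτ⟩
      · right
        push Not at a
        refine ⟨insert i (τ.erase j), ⟨by grind, by grind, j, h, by grind⟩, by grind, ?_⟩
        ext y; grind
    · by_cases a : j ∈ τ ∧ w₂ ∈ τ
      · right
        refine ⟨insert i (τ.erase j), ⟨by grind, by grind, x, by grind, by grind⟩, by grind, ?_⟩
        ext y; grind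
      · left; exact ⟨⟨by grind, a, i, h, hiτ⟩, hiτ⟩

theorem susp_comm {V : Type*} [DecidableEq V] (w₁ w₂ : V) (Δ : Set (Finset V)) :
    suspension w₁ w₂ Δ = suspension w₂ w₁ Δ := by
  unfold suspension
  rw [Set.pair_comm ({w₁} : Finset V) {w₂}]

/-- Let `∂Γ` be the boundary of the `d`-simplex on a `(d+1)`-element
vertex set `W` (`d ≥ 1`) and `S(∂Γ)` its suspension with two new vertices
`w₁ ≠ w₂ ∉ W`.  For any edge `σ = {i, j}` of `S(∂Γ)` not belonging to `∂Γ`, the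
contraction `C(σ, S(∂Γ))` (which deletes the vertex `i`) is the boundary of the
`(d+1)`-simplex on the `(d+2)`-element vertex set `(W ∪ {w₁, w₂}) \ {i}`. -/
theorem contraction_suspension_simplex_boundary
    {V : Type*} [DecidableEq V] (d : ℕ) (hd : 1 ≤ d)
    (W : Finset V) (hW : W.card = d + 1)
    (w₁ w₂ : V) (hw : w₁ ≠ w₂) (hw₁ : w₁ ∉ W) (hw₂ : w₂ ∉ W)
    (i j : V) (hij : i ≠ j)
    (hedge : ({i, j} : Finset V) ∈ suspension w₁ w₂ {σ : Finset V | σ ⊂ W})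
    (hnot : ({i, j} : Finset V) ∉ {σ : Finset V | σ ⊂ W}) :
    contraction i j (suspension w₁ w₂ {σ : Finset V | σ ⊂ W}) =
      {σ : Finset V | σ ⊂ (W ∪ {w₁, w₂}).erase i} := by
  rw [mem_susp_iff W w₁ w₂ hw hw₁ hw₂] at hedge
  obtain ⟨h1, h2, x, hx, hxe⟩ := hedge
  rw [Set.mem_setOf_eq, ssub_iff] at hnot
  have hnot' : ¬ (i ∈ W ∧ j ∈ W) := fun h => hnot ⟨by grind, x, hx, hxe⟩
  have hi := h1 i (by simp)
  have hj := h1 j (by simp)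
  by_cases h : (i = w₁ ∧ j ∈ W) ∨ (i ∈ W ∧ j = w₁)
  · exact contr_aux W w₁ w₂ hw hw₁ hw₂ i j h
  · rw [susp_comm, Finset.pair_comm w₁ w₂]
    exact contr_aux W w₂ w₁ hw.symm hw₂ hw₁ i j (by grind)
end

section
/- Let k be a field, n ≥ 1, and let A = ⊕_{i≥0} A_i be a commutative graded k-algebra with A_0 = k, A_i = 0 for i > 2n, A generated as a k-algebra by its degree-1 component A_1, dim_k A_{2n} = 1, and such that for every 0 ≤ i ≤ 2n the multiplication pairing A_i × A_{2n−i} → A_{2n} is nondegenerate (for every nonzero x ∈ A_i there exists y ∈ A_{2n−i} with xy ≠ 0). If every nonzero element u ∈ A_n satisfies u² ≠ 0, then for every 0 ≤ i ≤ n and every nonzero u ∈ A_i one has u² ≠ 0. -/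
theorem aux_pow_le {k A : Type*} [Field k] [CommRing A] [Algebra k A]
    (𝒜 : ℕ → Submodule k A) [GradedAlgebra 𝒜] (r : ℕ) : 𝒜 1 ^ r ≤ 𝒜 r := by
  induction r with
  | zero =>
    rw [pow_zero, Submodule.one_le]
    exact SetLike.GradedOne.one_mem
  | succ r ih =>
    rw [pow_succ, Submodule.mul_le]
    intro a ha b hb
    exact SetLike.GradedMul.mul_mem (ih ha) hb

theorem aux_le_pow {k A : Type*} [Field k] [CommRing A] [Algebra k A]
    (𝒜 : ℕ → Submodule k A) [GradedAlgebra 𝒜]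
    (hgen : Algebra.adjoin k (𝒜 1 : Set A) = ⊤) (m : ℕ) : 𝒜 m ≤ 𝒜 1 ^ m := by
  have hmon : ∀ a ∈ Submonoid.closure (𝒜 1 : Set A), ∃ r : ℕ, a ∈ 𝒜 1 ^ r := by
    intro a ha
    induction ha using Submonoid.closure_induction with
    | mem x hx => exact ⟨1, by simpa using hx⟩
    | one => exact ⟨0, by rw [pow_zero]; exact Submodule.one_le.mp le_rfl⟩
    | mul x y _ _ hx hy =>
      obtain ⟨r, hr⟩ := hx
      obtain ⟨t, ht⟩ := hy
      exact ⟨r + t, by rw [pow_add]; exact Submodule.mul_mem_mul hr ht⟩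
  have key : ∀ a : A, (DirectSum.decompose 𝒜 a m : A) ∈ 𝒜 1 ^ m := by
    intro a
    have ha : a ∈ Submodule.span k (Submonoid.closure (𝒜 1 : Set A) : Set A) := by
      rw [← Algebra.adjoin_eq_span, hgen]
      trivial
    induction ha using Submodule.span_induction with
    | mem x hx =>
      obtain ⟨r, hr⟩ := hmon x hx
      by_cases h : r = m
      · subst h
        rw [DirectSum.decompose_of_mem_same 𝒜 (aux_pow_le 𝒜 r hr)]
        exact hr
      · rw [DirectSum.decompose_of_mem_ne 𝒜 (aux_pow_le 𝒜 r hr) h]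
        exact zero_mem _
    | zero => simp
    | add x y _ _ hx hy =>
      rw [DirectSum.decompose_add]
      exact add_mem hx hy
    | smul c x _ hx =>
      rw [DirectSum.decompose_smul]
      exact Submodule.smul_mem _ c hx
  intro a ha
  have := key a
  rwa [DirectSum.decompose_of_mem_same 𝒜 ha] at this

/-- the reduction used in the proof of Proposition 4.2. Let `A` be a
commutative graded algebra over a field `k` with `A₀ = k`, `Aᵢ = 0` for `i > 2n`,
generated as a `k`-algebra by `A₁`, `dim_k A_{2n} = 1`, and such that every
multiplication pairing `Aᵢ × A_{2n-i} → A_{2n}` is nondegenerate.  If every nonzero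
`u ∈ Aₙ` satisfies `u² ≠ 0`, then for every `0 ≤ i ≤ n` every nonzero `u ∈ Aᵢ`
satisfies `u² ≠ 0`. -/
theorem anisotropic_of_middle_anisotropic
    (k A : Type*) [Field k] [CommRing A] [Algebra k A]
    (𝒜 : ℕ → Submodule k A) [GradedAlgebra 𝒜]
    (n : ℕ) (hn : 1 ≤ n)
    (h0 : 𝒜 0 = Submodule.span k {(1 : A)})
    (htop : ∀ i : ℕ, 2 * n < i → 𝒜 i = ⊥)
    (hgen : Algebra.adjoin k (𝒜 1 : Set A) = ⊤)
    (hdim : Module.finrank k (𝒜 (2 * n)) = 1)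
    (hpair : ∀ i ≤ 2 * n, ∀ x ∈ 𝒜 i, x ≠ 0 → ∃ y ∈ 𝒜 (2 * n - i), x * y ≠ 0)
    (hmid : ∀ u ∈ 𝒜 n, u ≠ 0 → u ^ 2 ≠ 0) :
    ∀ i ≤ n, ∀ u ∈ 𝒜 i, u ≠ 0 → u ^ 2 ≠ 0 := by
  intro i hi u hu hu0 hsq
  obtain ⟨y, hy, huy⟩ := hpair i (by omega) u hu hu0
  have hv : ∃ v ∈ 𝒜 (n - i), u * v ≠ 0 := by
    by_contra! hcon
    apply huy
    have h1 := aux_le_pow 𝒜 hgen _ hy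
    rw [show 2 * n - i = (n - i) + n by omega, pow_add] at h1
    clear hy huy
    induction h1 using Submodule.mul_induction_on' with
    | mem_mul_mem a ha b hb =>
      rw [← mul_assoc, hcon a (aux_pow_le 𝒜 _ ha), zero_mul]
    | add a _ b _ ha hb => rw [mul_add, ha, hb, add_zero]
  obtain ⟨v, hv, huv⟩ := hv
  have hm : u * v ∈ 𝒜 n := by
    have := SetLike.GradedMul.mul_mem hu hv
    rwa [show i + (n - i) = n by omega] at this
  exact hmid _ hm huv (by rw [mul_pow, hsq, zero_mul])
end
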